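/- arXiv:2209.06310 — 6 statements merged into one kernel-verified Lean document; each statement's English description precedes it below -/
import Mathlib

section
/- Let X be a real normed space with topological dual X', and let C ⊆ X be a nonempty set. Suppose U, V ⊆ X' are nonempty weak*-compact sets (compact in σ(X',X)) such that C = {x ∈ X : f(x) > 0 for all f ∈ U} = {x ∈ X : f(x) > 0 for all f ∈ V}. Then the weak*-closures of co(cone(U)) and co(cone(V)) coincide, where cone(U) := {λf : λ > 0, f ∈ U} and co denotes convex hull. -/
/-- Every weak*-continuous linear functional on the dual is evaluation at a point. -/
theorem WeakDual.exists_eq_eval {X : Type*} [NormedAddCommGroup X] [NormedSpace ℝ X]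
    (φ : StrongDual ℝ (WeakDual ℝ X)) : ∃ x : X, ∀ f : WeakDual ℝ X, φ f = f x := by
  obtain ⟨x, hx⟩ := LinearMap.dualEmbedding_surjective (topDualPairing ℝ X) φ
  exact ⟨x, fun f => (DFunLike.congr_fun hx f).symm⟩

/-- If the strict positivity set of `U` is nonempty and contained in that of `V`, then the
weak*-closed convex conic hull of `V` is contained in that of `U`. -/
theorem WeakDual.closure_convexHull_cone_subset
    {X : Type*} [NormedAddCommGroup X] [NormedSpace ℝ X] {U V : Set (WeakDual ℝ X)}
    (hUne : U.Nonempty) (hne : {x : X | ∀ f ∈ U, 0 < f x}.Nonempty)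
    (hUV : {x : X | ∀ f ∈ U, 0 < f x} ⊆ {x : X | ∀ f ∈ V, 0 < f x}) :
    closure (convexHull ℝ {g : WeakDual ℝ X | ∃ r : ℝ, 0 < r ∧ ∃ f ∈ V, g = r • f})
      ⊆ closure (convexHull ℝ {g : WeakDual ℝ X | ∃ r : ℝ, 0 < r ∧ ∃ f ∈ U, g = r • f}) := by
  have : LocallyConvexSpace ℝ (WeakDual ℝ X) :=
    inferInstanceAs (LocallyConvexSpace ℝ (WeakBilin (topDualPairing ℝ X)))
  refine closure_minimal (convexHull_min ?_ (convex_convexHull ℝ _).closure) isClosed_closure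
  rintro _ ⟨r, hr, f, hf, rfl⟩
  by_contra hmem
  obtain ⟨φ, u, hφf, hφ⟩ :=
    geometric_hahn_banach_point_closed (convex_convexHull ℝ _).closure isClosed_closure hmem
  obtain ⟨x, hx⟩ := WeakDual.exists_eq_eval φ
  have hcone : ∀ g ∈ U, ∀ s : ℝ, 0 < s → u < s * g x := fun g hg s hs => by
    have h := hφ (s • g) (subset_closure (subset_convexHull ℝ _ ⟨s, hs, g, hg, rfl⟩))
    rwa [map_smul, hx, smul_eq_mul] at h
  rw [map_smul, hx, smul_eq_mul] at hφf
  have hu : u ≤ 0 := by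
    obtain ⟨g, hg⟩ := hUne
    have hlim : Filter.Tendsto (fun s : ℝ => s * g x) (nhdsWithin 0 (Set.Ioi 0)) (nhds 0) := by
      simpa using ((continuous_mul_const (g x)).tendsto 0).mono_left nhdsWithin_le_nhds
    exact ge_of_tendsto hlim (Filter.eventually_of_mem self_mem_nhdsWithin
      fun s hs => (hcone g hg s hs).le)
  have hnonneg : ∀ g ∈ U, 0 ≤ g x := fun g hg => by
    by_contra! hneg
    have h := hcone g hg ((u - 1) / g x) (div_pos_of_neg_of_neg (by linarith) hneg)
    rw [div_mul_cancel₀ _ hneg.ne] at h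
    linarith
  have hfx : f x < 0 := by
    by_contra! h
    linarith [mul_nonneg hr.le h]
  obtain ⟨c, hc⟩ := hne
  have hfc : 0 < f c := hUV hc f hf
  have ht : 0 < -f x / f c := div_pos (neg_pos.mpr hfx) hfc
  have hpos : 0 < f (x + (-f x / f c) • c) := hUV (fun g hg => by
    rw [map_add, map_smul, smul_eq_mul]
    exact add_pos_of_nonneg_of_pos (hnonneg g hg) (mul_pos ht (hc g hg))) f hf
  rw [map_add, map_smul, smul_eq_mul, div_mul_cancel₀ _ hfc.ne'] at hpos
  linarith


/-- **Proposition 3.11 (second part).** Let `X` be a real normed space, `C ⊆ X`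
nonempty, and `U, V` nonempty weak*-compact subsets of the dual both representing
`C` as `C = {x : f x > 0 for all f ∈ U}`. Then the weak*-closed convex conic hulls
of `U` and `V` coincide. -/
theorem weakstar_closure_convexHull_cone_unique
    {X : Type*} [NormedAddCommGroup X] [NormedSpace ℝ X]
    (C : Set X) (hCne : C.Nonempty)
    (U V : Set (WeakDual ℝ X))
    (hUne : U.Nonempty) (hUcp : IsCompact U)
    (hVne : V.Nonempty) (hVcp : IsCompact V)
    (hU : C = {x : X | ∀ f ∈ U, 0 < f x})
    (hV : C = {x : X | ∀ f ∈ V, 0 < f x}) :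
    closure (convexHull ℝ {g : WeakDual ℝ X | ∃ r : ℝ, 0 < r ∧ ∃ f ∈ U, g = r • f})
      = closure (convexHull ℝ
          {g : WeakDual ℝ X | ∃ r : ℝ, 0 < r ∧ ∃ f ∈ V, g = r • f}) := by
  subst hU
  exact (WeakDual.closure_convexHull_cone_subset hVne (hV ▸ hCne) hV.ge).antisymm
    (WeakDual.closure_convexHull_cone_subset hUne hCne hV.le)
end

section
/- Let X be a real normed space with topological dual X' (endowed with the dual norm), and let U ⊆ X be a nonempty weakly compact set (compact in the weak topology σ(X,X')). Then the set ⋂_{x ∈ U} G_x = {f ∈ X' : f(x) < 0 for all x ∈ U} is open in the norm topology of X'. -/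
theorem continuous_toWeakSpace_symm_apply
    {X : Type*} [NormedAddCommGroup X] [NormedSpace ℝ X] (f : X →L[ℝ] ℝ) :
    Continuous fun y : WeakSpace ℝ X => f ((toWeakSpace ℝ X).symm y) :=
  WeakBilin.eval_continuous (topDualPairing ℝ X).flip f

/-- A weakly compact set in a real normed space is norm bounded. -/
theorem exists_norm_le_of_isCompact_toWeakSpace_image
    {X : Type*} [NormedAddCommGroup X] [NormedSpace ℝ X]
    {U : Set X} (hU : IsCompact (toWeakSpace ℝ X '' U)) :
    ∃ C, ∀ x ∈ U, ‖x‖ ≤ C := by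
  obtain ⟨C, hC⟩ := banach_steinhaus
    (g := fun x : U => NormedSpace.inclusionInDoubleDual ℝ X x) fun f => by
      obtain ⟨C, hC⟩ := hU.exists_bound_of_continuousOn
        (continuous_toWeakSpace_symm_apply f).continuousOn
      exact ⟨C, fun x => by simpa using hC _ (Set.mem_image_of_mem _ x.2)⟩
  exact ⟨C, fun x hx =>
    ((NormedSpace.inclusionInDoubleDualLi ℝ (E := X)).norm_map x).symm.trans_le (hC ⟨x, hx⟩)⟩

/-- **Lemma 3.12.** Let `X` be a real normed space and `U ⊆ X` a nonempty weakly
compact set. Then `⋂_{x ∈ U} G_x = {f ∈ X' : f x < 0 for all x ∈ U}` is open in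
the dual-norm topology of `X'`. -/
theorem isOpen_inter_Gx_of_weakly_compact
    {X : Type*} [NormedAddCommGroup X] [NormedSpace ℝ X]
    (U : Set X) (hUne : U.Nonempty)
    (hUcp : IsCompact (toWeakSpace ℝ X '' U)) :
    IsOpen {f : X →L[ℝ] ℝ | ∀ x ∈ U, f x < 0} := by
  obtain ⟨C, hC⟩ := exists_norm_le_of_isCompact_toWeakSpace_image hUcp
  have hC0 : 0 ≤ C := (norm_nonneg _).trans (hC _ hUne.some_mem)
  rw [Metric.isOpen_iff]
  intro f hf
  obtain ⟨_, ⟨x₀, hx₀, rfl⟩, hmax⟩ := hUcp.exists_isMaxOn (hUne.image _)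
    (continuous_toWeakSpace_symm_apply f).continuousOn
  have hfx₀ : f x₀ < 0 := hf x₀ hx₀
  refine ⟨-f x₀ / (C + 1), div_pos (neg_pos.mpr hfx₀) (by positivity), fun g hg x hx => ?_⟩
  rw [Metric.mem_ball, dist_eq_norm, lt_div_iff₀ (by positivity)] at hg
  have hfx : f x ≤ f x₀ := by simpa using hmax (Set.mem_image_of_mem _ hx)
  have hgf : g x - f x ≤ ‖g - f‖ * (C + 1) := calc
    g x - f x ≤ ‖(g - f) x‖ := le_abs_self _
    _ ≤ ‖g - f‖ * ‖x‖ := (g - f).le_opNorm x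
    _ ≤ ‖g - f‖ * (C + 1) := by gcongr; linarith [hC x hx]
  linarith
end

section
/- Let X be a real Banach space with topological dual X', and let C ⊆ X be a subset. Then the following are equivalent: (i) C is a norm-closed cone; (ii) there exists a nonempty family 𝒦 of nonempty weak*-compact subsets of X' such that C = {x ∈ X : for every K ∈ 𝒦 there exists f ∈ K with f(x) ≥ 0}; (iii) there exists a nonempty family 𝒦 of nonempty weak*-compact convex subsets of X' such that C = {x ∈ X : for every K ∈ 𝒦 there exists f ∈ K with f(x) ≥ 0}. -/
lemma WeakDual.exists_norm_bound_of_isCompact {X : Type*} [NormedAddCommGroup X]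
    [NormedSpace ℝ X] [CompleteSpace X] {K : Set (WeakDual ℝ X)} (hK : IsCompact K) :
    ∃ M : ℝ, ∀ f ∈ K, ∀ x : X, |f x| ≤ M * ‖x‖ := by
  obtain ⟨M, hM⟩ := banach_steinhaus (g := fun f : K => WeakDual.toStrongDual f.1) fun x => by
    obtain ⟨B, hB⟩ := hK.exists_bound_of_continuousOn
      (WeakDual.eval_continuous (𝕜 := ℝ) x).continuousOn
    exact ⟨B, fun f => hB f.1 f.2⟩
  exact ⟨M, fun f hf x => (WeakDual.toStrongDual f).le_of_opNorm_le (hM ⟨f, hf⟩) x⟩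

lemma WeakDual.isClosed_setOf_exists_nonneg {X : Type*} [NormedAddCommGroup X]
    [NormedSpace ℝ X] [CompleteSpace X] {K : Set (WeakDual ℝ X)} (hK : IsCompact K)
    (hne : K.Nonempty) : IsClosed {x : X | ∃ f ∈ K, 0 ≤ f x} := by
  obtain ⟨M, hM⟩ := exists_norm_bound_of_isCompact hK
  refine isClosed_of_closure_subset fun x hx => ?_
  obtain ⟨f₀, hf₀, hmax⟩ := hK.exists_isMaxOn hne
    (WeakDual.eval_continuous (𝕜 := ℝ) x).continuousOn
  refine ⟨f₀, hf₀, ?_⟩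
  have hclosed : IsClosed {y : X | 0 ≤ f₀ x + M * ‖y - x‖} :=
    isClosed_le continuous_const (by fun_prop)
  have hsub : {y : X | ∃ f ∈ K, 0 ≤ f y} ⊆ {y : X | 0 ≤ f₀ x + M * ‖y - x‖} := by
    rintro y ⟨f, hf, hfy⟩
    have hle : f x ≤ f₀ x := hmax hf
    have hb := (le_abs_self _).trans (hM f hf (y - x))
    rw [map_sub] at hb
    show 0 ≤ f₀ x + M * ‖y - x‖
    linarith
  simpa using closure_minimal hsub hclosed hx

/-- A ball around `x` that misses a ray through `y` can be separated from `y` by a functional taken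
from a fixed weak*-compact set. -/
lemma WeakDual.exists_mem_polar_ball_of_disjoint {X : Type*} [NormedAddCommGroup X]
    [NormedSpace ℝ X] {x y : X} {r : ℝ} (hr : 0 < r)
    (hdisj : ∀ t : ℝ, 0 ≤ t → t • y ∉ Metric.ball x r) :
    ∃ f ∈ WeakDual.polar ℝ (Metric.ball (0 : X) r), f x = -1 ∧ 0 ≤ f y := by
  obtain ⟨f, u, hlt, hle⟩ := geometric_hahn_banach_open (convex_ball x r) Metric.isOpen_ball
    ((convex_Ici (0 : ℝ)).linear_image (LinearMap.toSpanSingleton ℝ X y)) (by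
      rw [Set.disjoint_right]
      rintro _ ⟨t, ht, rfl⟩
      exact hdisj t ht)
  replace hle : ∀ t : ℝ, 0 ≤ t → u ≤ t * f y := fun t ht => by
    simpa using hle (t • y) ⟨t, ht, rfl⟩
  have hu : u ≤ 0 := by simpa using hle 0 le_rfl
  have hx : f x < 0 := (hlt x (Metric.mem_ball_self hr)).trans_le hu
  have hy : 0 ≤ f y := by
    by_contra! h
    have := hle ((u - 1) / f y) (div_nonneg_of_nonpos (by linarith) h.le)
    rw [div_mul_cancel₀ _ h.ne] at this
    linarith
  refine ⟨StrongDual.toWeakDual ((-f x)⁻¹ • f), fun z hz => ?_, ?_, ?_⟩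
  · have hz' : ‖z‖ < r := by simpa using hz
    have h₁ := hlt (x + z) (by simpa using hz')
    have h₂ := hlt (x - z) (by simpa [mem_ball_iff_norm] using hz')
    rw [map_add] at h₁
    rw [map_sub] at h₂
    show ‖(-f x)⁻¹ * f z‖ ≤ 1
    rw [inv_mul_eq_div, Real.norm_eq_abs, abs_div, abs_of_pos (neg_pos.2 hx),
      div_le_one (neg_pos.2 hx), abs_le]
    constructor <;> linarith
  · show (-f x)⁻¹ * f x = -1
    rw [inv_neg, neg_mul, inv_mul_cancel₀ hx.ne]
  · exact mul_nonneg (inv_nonneg.2 (neg_pos.2 hx).le) hy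

lemma WeakDual.convex_polar {X : Type*} [NormedAddCommGroup X] [NormedSpace ℝ X] (s : Set X) :
    Convex ℝ (WeakDual.polar ℝ s) := by
  intro f hf g hg a b ha hb hab z hz
  have h : a • f z + b • g z ∈ Metric.closedBall (0 : ℝ) 1 :=
    convex_closedBall 0 1 (by simpa using hf z hz) (by simpa using hg z hz) ha hb hab
  simpa using h

/-- **Theorem 3.13 (closed cones in Banach spaces).** Let `X` be a real Banach
space and `C ⊆ X`. TFAE: (i) `C` is a norm-closed cone; (ii) `C` is represented by
a nonempty family of nonempty weak*-compact subsets of the dual; (iii) `C` is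
represented by a nonempty family of nonempty weak*-compact convex subsets of the
dual. -/
theorem closed_cone_characterization
    {X : Type*} [NormedAddCommGroup X] [NormedSpace ℝ X] [CompleteSpace X]
    (C : Set X) :
    List.TFAE
      [ C.Nonempty ∧ IsClosed C ∧ ∀ r : ℝ, 0 < r → ∀ x ∈ C, r • x ∈ C,
        ∃ 𝒦 : Set (Set (WeakDual ℝ X)), 𝒦.Nonempty ∧
          (∀ K ∈ 𝒦, K.Nonempty ∧ IsCompact K) ∧
          C = {x : X | ∀ K ∈ 𝒦, ∃ f ∈ K, 0 ≤ f x},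
        ∃ 𝒦 : Set (Set (WeakDual ℝ X)), 𝒦.Nonempty ∧
          (∀ K ∈ 𝒦, K.Nonempty ∧ IsCompact K ∧ Convex ℝ K) ∧
          C = {x : X | ∀ K ∈ 𝒦, ∃ f ∈ K, 0 ≤ f x} ] := by
  tfae_have 3 → 2 := fun ⟨𝒦, hne, h𝒦, hC⟩ =>
    ⟨𝒦, hne, fun K hK => ⟨(h𝒦 K hK).1, (h𝒦 K hK).2.1⟩, hC⟩
  tfae_have 2 → 1 := by
    rintro ⟨𝒦, -, h𝒦, rfl⟩
    refine ⟨⟨0, fun K hK => ?_⟩, ?_, fun r hr x hx K hK => ?_⟩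
    · obtain ⟨f, hf⟩ := (h𝒦 K hK).1
      exact ⟨f, hf, (map_zero f).ge⟩
    · simp only [Set.ofPred_forall]
      exact isClosed_biInter fun K hK =>
        WeakDual.isClosed_setOf_exists_nonneg (h𝒦 K hK).2 (h𝒦 K hK).1
    · obtain ⟨f, hf, hfx⟩ := hx K hK
      exact ⟨f, hf, by rw [map_smul]; exact mul_nonneg hr.le hfx⟩
  tfae_have 1 → 3 := by
    rintro ⟨⟨c, hc⟩, hclosed, hcone⟩
    have hzero : (0 : X) ∈ C := by
      have ht : Filter.Tendsto (fun t : ℝ => t • c) (nhdsWithin 0 (Set.Ioi 0)) (nhds 0) := by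
        have : Continuous fun t : ℝ => t • c := by fun_prop
        simpa using (this.tendsto 0).mono_left nhdsWithin_le_nhds
      exact hclosed.mem_of_tendsto ht
        (Filter.eventually_of_mem self_mem_nhdsWithin fun t ht => hcone t ht c hc)
    have hray : ∀ y ∈ C, ∀ t : ℝ, 0 ≤ t → t • y ∈ C := fun y hy t ht => by
      rcases ht.eq_or_lt with rfl | ht
      · simpa using hzero
      · exact hcone t ht y hy
    refine ⟨{K | (K.Nonempty ∧ IsCompact K ∧ Convex ℝ K) ∧ ∀ y ∈ C, ∃ f ∈ K, 0 ≤ f y},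
      ⟨{0}, ⟨Set.singleton_nonempty _, isCompact_singleton, convex_singleton _⟩,
        fun y _ => ⟨0, rfl, le_rfl⟩⟩, fun K hK => hK.1,
      Set.Subset.antisymm (fun y hy K hK => hK.2 y hy) fun x hx => ?_⟩
    by_contra hxC
    obtain ⟨r, hr, hball⟩ := Metric.isOpen_iff.1 hclosed.isOpen_compl x hxC
    have hmeet : ∀ y ∈ C, ∃ f ∈ WeakDual.polar ℝ (Metric.ball (0 : X) r) ∩ {f | f x = -1},
        0 ≤ f y := fun y hy => by
      obtain ⟨f, hf, hfx, hfy⟩ := WeakDual.exists_mem_polar_ball_of_disjoint (x := x) hr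
        fun t ht hmem => hball hmem (hray y hy t ht)
      exact ⟨f, ⟨hf, hfx⟩, hfy⟩
    obtain ⟨f, ⟨-, hfx⟩, hf⟩ := hx _ ⟨⟨(hmeet 0 hzero).imp fun _ h => h.1,
      (WeakDual.isCompact_polar ℝ (Metric.ball_mem_nhds 0 hr)).inter_right
        (isClosed_eq (WeakDual.eval_continuous x) continuous_const),
      (WeakDual.convex_polar _).inter fun f hf g hg a b _ _ hab => by
        show a * f x + b * g x = -1
        rw [show f x = -1 from hf, show g x = -1 from hg]
        linarith⟩, hmeet⟩
    rw [show f x = -1 from hfx] at hf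
    norm_num at hf
  tfae_finish
end

section
/- Let Z be a separable metric space, let Δ(Z) denote the set of Borel probability measures on Z, and let ℛ be a binary relation on Δ(Z). Then ℛ is reflexive and satisfies the independence axiom if and only if there exists a nonempty family 𝒰 of nonempty subsets of C_b(Z) such that for all p, q ∈ Δ(Z): (p, q) ∈ ℛ if and only if for every U ∈ 𝒰 there exists u ∈ U with ∫ u dp ≥ ∫ u dq. -/
open scoped NNReal BoundedContinuousFunction
open MeasureTheory

theorem integral_nnreal_smul_add_smul {Z : Type*} [TopologicalSpace Z] [MeasurableSpace Z]
    [OpensMeasurableSpace Z] (p r : Measure Z) [IsFiniteMeasure p] [IsFiniteMeasure r]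
    (a b : ℝ≥0) (u : Z →ᵇ ℝ) :
    ∫ z, u z ∂(a • p + b • r) = a * ∫ z, u z ∂p + b * ∫ z, u z ∂r := by
  rw [integral_add_measure (u.integrable _) (u.integrable _), integral_smul_nnreal_measure,
    integral_smul_nnreal_measure]
  rfl

theorem isProbabilityMeasure_nnreal_smul_add_smul {Z : Type*} [MeasurableSpace Z]
    (p r : Measure Z) [IsProbabilityMeasure p] [IsProbabilityMeasure r] {a b : ℝ≥0}
    (hab : a + b = 1) : IsProbabilityMeasure (a • p + b • r) := by
  constructor
  simp only [Measure.add_apply, Measure.smul_apply, measure_univ, ENNReal.smul_def, smul_eq_mul,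
    mul_one]
  exact_mod_cast hab

/-- A linear functional that is negative wherever a nonzero linear functional `f` is negative is
a positive multiple of `f`. -/
theorem exists_pos_eq_mul_of_neg_imp_neg {E : Type*} [AddCommGroup E] [Module ℝ E]
    (f g : E →ₗ[ℝ] ℝ) {x₀ : E} (hx₀ : f x₀ < 0) (h : ∀ x, f x < 0 → g x < 0) :
    ∃ c : ℝ, 0 < c ∧ ∀ x, g x = c * f x := by
  refine ⟨g x₀ / f x₀, div_pos_of_neg_of_neg (h _ hx₀) hx₀, fun x => ?_⟩
  have key : ∀ t : ℝ, g x₀ + t * (g x - f x / f x₀ * g x₀) < 0 := fun t => by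
    have := h (x₀ + t • (x - (f x / f x₀) • x₀)) (by
      simp only [map_add, map_smul, map_sub, smul_eq_mul]
      rw [div_mul_cancel₀ _ hx₀.ne]
      simpa using hx₀)
    simpa only [map_add, map_smul, map_sub, smul_eq_mul] using this
  have hv : g x - f x / f x₀ * g x₀ = 0 := by
    by_contra hv
    have := key (-g x₀ / (g x - f x / f x₀ * g x₀))
    rw [div_mul_cancel₀ _ hv] at this
    simp at this
  rw [sub_eq_zero.mp hv]
  ring

/-- The functional `u ↦ ∫ u dp - ∫ u dq` on bounded continuous functions. -/
noncomputable def integralDiff {Z : Type*} [TopologicalSpace Z] [MeasurableSpace Z]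
    [OpensMeasurableSpace Z] (p q : Measure Z) [IsFiniteMeasure p] [IsFiniteMeasure q] :
    (Z →ᵇ ℝ) →ₗ[ℝ] ℝ where
  toFun u := ∫ z, u z ∂p - ∫ z, u z ∂q
  map_add' u v := by
    simp only [BoundedContinuousFunction.coe_add, Pi.add_apply]
    rw [integral_add (u.integrable _) (v.integrable _),
      integral_add (u.integrable _) (v.integrable _)]
    ring
  map_smul' c u := by
    simp only [BoundedContinuousFunction.coe_smul, smul_eq_mul, integral_const_mul,
      RingHom.id_apply]
    ring

theorem exists_integral_lt_integral_of_ne {Z : Type*} [TopologicalSpace Z] [MeasurableSpace Z]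
    [BorelSpace Z] [HasOuterApproxClosed Z] {p q : Measure Z} [IsFiniteMeasure p]
    [IsFiniteMeasure q] (hpq : p ≠ q) : ∃ u : Z →ᵇ ℝ, ∫ z, u z ∂p < ∫ z, u z ∂q := by
  by_contra! h
  refine hpq (ext_of_forall_integral_eq_of_IsFiniteMeasure fun u => le_antisymm ?_ (h u))
  simpa [integral_neg] using h (-u)

/-- If `p' - q'` is a positive multiple of `p - q`, both pairs have a common mixture. -/
theorem exists_mixture_eq_of_integral_sub_eq_mul {Z : Type*} [TopologicalSpace Z]
    [MeasurableSpace Z] [BorelSpace Z] [HasOuterApproxClosed Z] {p q p' q' : Measure Z}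
    [IsFiniteMeasure p] [IsFiniteMeasure q] [IsFiniteMeasure p'] [IsFiniteMeasure q'] {c : ℝ}
    (hc : 0 < c)
    (h : ∀ u : Z →ᵇ ℝ, ∫ z, u z ∂p' - ∫ z, u z ∂q' = c * (∫ z, u z ∂p - ∫ z, u z ∂q)) :
    ∃ a : ℝ≥0, 0 < a ∧ a < 1 ∧ a • q' + (1 - a) • p = (1 - a) • q + a • p' := by
  obtain ⟨a, ha⟩ : ∃ a : ℝ≥0, (a : ℝ) = (1 + c)⁻¹ :=
    ⟨Real.toNNReal (1 + c)⁻¹, Real.coe_toNNReal _ (by positivity)⟩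
  have ha0 : 0 < a := by
    rw [← NNReal.coe_pos, ha]
    positivity
  have ha1 : a < 1 := by
    rw [← NNReal.coe_lt_coe, ha]
    exact inv_lt_one_of_one_lt₀ (by linarith)
  refine ⟨a, ha0, ha1, ext_of_forall_integral_eq_of_IsFiniteMeasure fun u => ?_⟩
  rw [integral_nnreal_smul_add_smul, integral_nnreal_smul_add_smul, NNReal.coe_sub ha1.le, ha,
    NNReal.coe_one]
  have := h u
  have h1 : 1 + c ≠ 0 := by positivity
  field_simp
  linarith

/-- **Corollary 4.2 (expected multi-utility, GMOS).** Let `Z` be a separable metric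
space and `ℛ` a binary relation on the Borel probability measures on `Z`. Then `ℛ`
is reflexive and satisfies the independence axiom iff there is a nonempty family
`𝒰` of nonempty subsets of `C_b(Z)` with: `(p,q) ∈ ℛ` iff for every `U ∈ 𝒰` there
is `u ∈ U` with `∫ u dp ≥ ∫ u dq`. -/
theorem reflexive_independence_iff_multiutility
    {Z : Type*} [MetricSpace Z] [TopologicalSpace.SeparableSpace Z]
    [MeasurableSpace Z] [BorelSpace Z]
    (ℛ : Measure Z → Measure Z → Prop) :
    ((∀ p : Measure Z, IsProbabilityMeasure p → ℛ p p) ∧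
      (∀ p q r : Measure Z, IsProbabilityMeasure p → IsProbabilityMeasure q →
        IsProbabilityMeasure r → ∀ α : ℝ≥0, 0 < α → α < 1 →
          (ℛ p q ↔ ℛ (α • p + (1 - α) • r) (α • q + (1 - α) • r))))
      ↔ ∃ 𝒰 : Set (Set (Z →ᵇ ℝ)), 𝒰.Nonempty ∧ (∀ U ∈ 𝒰, U.Nonempty) ∧
          ∀ p q : Measure Z, IsProbabilityMeasure p → IsProbabilityMeasure q →
            (ℛ p q ↔ ∀ U ∈ 𝒰, ∃ u ∈ U, ∫ z, u z ∂q ≤ ∫ z, u z ∂p) := by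
  constructor
  · rintro ⟨hrefl, hind⟩
    refine ⟨insert Set.univ {U | ∃ p q : Measure Z, IsProbabilityMeasure p ∧
      IsProbabilityMeasure q ∧ ¬ ℛ p q ∧ U = {u | ∫ z, u z ∂p < ∫ z, u z ∂q}},
      Set.insert_nonempty _ _, ?_, ?_⟩
    · rintro U (rfl | ⟨p, q, hp, hq, hpq, rfl⟩)
      · exact Set.univ_nonempty
      · exact exists_integral_lt_integral_of_ne fun h => hpq (h ▸ hrefl p hp)
    · intro p' q' hp' hq'
      constructor
      · rintro hR U (rfl | ⟨p, q, hp, hq, hpq, rfl⟩)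
        · exact ⟨0, Set.mem_univ _, by simp⟩
        · by_contra! hcon
          obtain ⟨u₀, hu₀⟩ :=
            exists_integral_lt_integral_of_ne fun h : p = q => hpq (h ▸ hrefl p hp)
          obtain ⟨c, hc, h⟩ := exists_pos_eq_mul_of_neg_imp_neg (integralDiff p q)
            (integralDiff p' q') (x₀ := u₀) (sub_neg.mpr hu₀)
            fun u hu => sub_neg.mpr (hcon u (sub_neg.mp hu))
          obtain ⟨a, ha, ha1, hmix⟩ := exists_mixture_eq_of_integral_sub_eq_mul hc h
          have hR' := (hind p' q' p hp' hq' hp a ha ha1).mp hR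
          refine hpq ((hind p q p' hp hq hp' (1 - a) (tsub_pos_of_lt ha1)
            (tsub_lt_self one_pos ha)).mpr ?_)
          rwa [tsub_tsub_cancel_of_le ha1.le, ← hmix, add_comm ((1 - a) • p)]
      · intro h
        by_contra hR
        obtain ⟨u, hu, hle⟩ := h _ (Or.inr ⟨p', q', hp', hq', hR, rfl⟩)
        exact hle.not_gt hu
  · rintro ⟨𝒰, -, hne, h𝒰⟩
    refine ⟨fun p hp => (h𝒰 p p hp hp).mpr fun U hU => ?_, ?_⟩
    · obtain ⟨u, hu⟩ := hne U hU
      exact ⟨u, hu, le_rfl⟩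
    · intro p q r hp hq hr α hα hα1
      have hsum : α + (1 - α) = 1 := add_tsub_cancel_of_le hα1.le
      rw [h𝒰 p q hp hq, h𝒰 _ _ (isProbabilityMeasure_nnreal_smul_add_smul p r hsum)
        (isProbabilityMeasure_nnreal_smul_add_smul q r hsum)]
      have hα' : (0 : ℝ) < α := hα
      simp only [integral_nnreal_smul_add_smul, add_le_add_iff_right,
        mul_le_mul_iff_right₀ hα']
end

section
/- Let Z be a separable metric space, let Δ(Z) denote the set of Borel probability measures on Z, let ℛ be a binary relation on Δ(Z), and set 𝒰₀ := { {u ∈ C_b(Z) : ∫ u dp < ∫ u dq} : p, q ∈ Δ(Z) }. Then ℛ is reflexive, transitive, and satisfies the independence axiom if and only if there exists a nonempty family 𝒰 of nonempty subsets of C_b(Z) such that (a) for all p, q ∈ Δ(Z): (p, q) ∈ ℛ if and only if for every U ∈ 𝒰 there exists u ∈ U with ∫ u dp ≥ ∫ u dq; and (b) for all U₁, U₂, V ∈ 𝒰₀ with V ⊆ U₁ ∪ U₂: if no member of 𝒰 is a subset of U₁ and no member of 𝒰 is a subset of U₂, then no member of 𝒰 is a subset of V. -/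
open scoped NNReal BoundedContinuousFunction
open MeasureTheory

/-- A linear functional that is nonpositive wherever `g` is nonpositive is a nonnegative multiple
of `g`. -/
lemma exists_nonneg_smul_of_forall_nonpos {E : Type*} [AddCommGroup E] [Module ℝ E]
    (f g : E →ₗ[ℝ] ℝ) (h : ∀ x, g x ≤ 0 → f x ≤ 0) :
    ∃ c : ℝ, 0 ≤ c ∧ ∀ x, f x = c * g x := by
  by_cases hf : ∀ x, f x ≤ 0
  · refine ⟨0, le_rfl, fun x => ?_⟩
    have h₁ := hf x
    have h₂ := hf (-x)
    rw [map_neg] at h₂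
    linarith
  · push Not at hf
    obtain ⟨y, hy⟩ := hf
    have hgy : 0 < g y := not_le.1 fun hle => (h y hle).not_gt hy
    refine ⟨f y / g y, by positivity, fun x => ?_⟩
    have hker : g (x - (g x / g y) • y) = 0 := by
      simp only [map_sub, map_smul, smul_eq_mul]
      field_simp
      ring
    have h₁ := h _ hker.le
    have h₂ := h (-(x - (g x / g y) • y)) (by rw [map_neg, hker, neg_zero])
    rw [map_neg] at h₂
    have h₃ : f x - g x / g y * f y = 0 := by
      simp only [map_sub, map_smul, smul_eq_mul] at h₁ h₂
      linarith
    rw [sub_eq_zero.1 h₃]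
    ring

/-- Farkas' lemma for two linear functionals on a real vector space. -/
lemma exists_nonneg_combination_of_forall_nonpos {E : Type*} [AddCommGroup E] [Module ℝ E]
    (f g₁ g₂ : E →ₗ[ℝ] ℝ) (h : ∀ x, g₁ x ≤ 0 → g₂ x ≤ 0 → f x ≤ 0) :
    ∃ c₁ c₂ : ℝ, 0 ≤ c₁ ∧ 0 ≤ c₂ ∧ ∀ x, f x = c₁ * g₁ x + c₂ * g₂ x := by
  by_cases hf : ∀ x, g₁ x ≤ 0 → f x ≤ 0
  · obtain ⟨c, hc, hfg⟩ := exists_nonneg_smul_of_forall_nonpos f g₁ hf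
    exact ⟨c, 0, hc, le_rfl, fun x => by rw [hfg x]; ring⟩
  · push Not at hf
    obtain ⟨y, hy₁, hy⟩ := hf
    have hy₂ : 0 < g₂ y := not_le.1 fun hle => (h y hy₁ hle).not_gt hy
    let P : E →ₗ[ℝ] E := LinearMap.id - ((g₂ y)⁻¹ • g₂).smulRight y
    have hP : ∀ x, P x = x - ((g₂ y)⁻¹ * g₂ x) • y := fun x => by simp [P]
    have hker : ∀ x, g₂ (P x) = 0 := fun x => by
      rw [hP, map_sub, map_smul, smul_eq_mul]
      field_simp
      ring
    obtain ⟨c, hc, hfg⟩ := exists_nonneg_smul_of_forall_nonpos (f ∘ₗ P) (g₁ ∘ₗ P)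
      fun x hx => h (P x) hx (hker x).le
    refine ⟨c, (f y - c * g₁ y) / g₂ y, hc, div_nonneg ?_ hy₂.le, fun x => ?_⟩
    · nlinarith
    · have hx := hfg x
      simp only [LinearMap.comp_apply, hP, map_sub, map_smul, smul_eq_mul] at hx
      rw [eq_add_of_sub_eq hx]
      field_simp
      ring

lemma isProbabilityMeasure_smul_add_smul {Ω : Type*} [MeasurableSpace Ω] (p q : Measure Ω)
    [IsProbabilityMeasure p] [IsProbabilityMeasure q] {α β : ℝ≥0} (h : α + β = 1) :
    IsProbabilityMeasure (α • p + β • q) := by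
  constructor
  simp only [Measure.coe_add, Pi.add_apply, Measure.smul_apply, measure_univ, ENNReal.smul_def,
    smul_eq_mul, mul_one]
  exact_mod_cast h

lemma rel_smul_add_smul {Z : Type*} [MeasurableSpace Z] {ℛ : Measure Z → Measure Z → Prop}
    (htrans : ∀ p q r : Measure Z, IsProbabilityMeasure p → IsProbabilityMeasure q →
      IsProbabilityMeasure r → ℛ p q → ℛ q r → ℛ p r)
    (hind : ∀ p q r : Measure Z, IsProbabilityMeasure p → IsProbabilityMeasure q →
      IsProbabilityMeasure r → ∀ α β : ℝ≥0, 0 < α → 0 < β → α + β = 1 →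
        (ℛ p q ↔ ℛ (α • p + β • r) (α • q + β • r)))
    {p₁ q₁ p₂ q₂ : Measure Z} [IsProbabilityMeasure p₁] [IsProbabilityMeasure q₁]
    [IsProbabilityMeasure p₂] [IsProbabilityMeasure q₂] (h₁ : ℛ p₁ q₁) (h₂ : ℛ p₂ q₂)
    {α β : ℝ≥0} (h : α + β = 1) :
    ℛ (α • p₁ + β • p₂) (α • q₁ + β • q₂) := by
  rcases eq_zero_or_pos α with rfl | hα
  · obtain rfl : β = 1 := by simpa using h
    simpa using h₂
  rcases eq_zero_or_pos β with rfl | hβ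
  · obtain rfl : α = 1 := by simpa using h
    simpa using h₁
  have s₁ := (hind p₁ q₁ p₂ ‹_› ‹_› ‹_› α β hα hβ h).1 h₁
  have s₂ := (hind p₂ q₂ q₁ ‹_› ‹_› ‹_› β α hβ hα (by rwa [add_comm])).1 h₂
  rw [add_comm (β • p₂), add_comm (β • q₂)] at s₂
  exact htrans _ _ _ (isProbabilityMeasure_smul_add_smul _ _ h)
    (isProbabilityMeasure_smul_add_smul _ _ h) (isProbabilityMeasure_smul_add_smul _ _ h) s₁ s₂

section

variable {Z : Type*} [MetricSpace Z] [MeasurableSpace Z] [BorelSpace Z]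

/-- The functional `u ↦ ∫ u dq - ∫ u dp` on bounded continuous functions. -/
noncomputable def integralDifference (p q : Measure Z) [IsFiniteMeasure p] [IsFiniteMeasure q] :
    (Z →ᵇ ℝ) →ₗ[ℝ] ℝ where
  toFun u := ∫ z, u z ∂q - ∫ z, u z ∂p
  map_add' u v := by
    simp only [BoundedContinuousFunction.coe_add, Pi.add_apply]
    rw [integral_add (u.integrable q) (v.integrable q),
      integral_add (u.integrable p) (v.integrable p)]
    ring
  map_smul' c u := by
    simp only [BoundedContinuousFunction.coe_smul, smul_eq_mul, RingHom.id_apply,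
      integral_const_mul]
    ring

lemma integral_smul_add_smul (p q : Measure Z) [IsFiniteMeasure p] [IsFiniteMeasure q]
    (α β : ℝ≥0) (u : Z →ᵇ ℝ) :
    ∫ z, u z ∂(α • p + β • q) = α * ∫ z, u z ∂p + β * ∫ z, u z ∂q := by
  rw [integral_add_measure (u.integrable _) (u.integrable _), integral_smul_nnreal_measure,
    integral_smul_nnreal_measure]
  rfl

variable {ℛ : Measure Z → Measure Z → Prop}

lemma rel_of_subset_union
    (hrefl : ∀ p : Measure Z, IsProbabilityMeasure p → ℛ p p)
    (htrans : ∀ p q r : Measure Z, IsProbabilityMeasure p → IsProbabilityMeasure q →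
      IsProbabilityMeasure r → ℛ p q → ℛ q r → ℛ p r)
    (hind : ∀ p q r : Measure Z, IsProbabilityMeasure p → IsProbabilityMeasure q →
      IsProbabilityMeasure r → ∀ α β : ℝ≥0, 0 < α → 0 < β → α + β = 1 →
        (ℛ p q ↔ ℛ (α • p + β • r) (α • q + β • r)))
    {p q p₁ q₁ p₂ q₂ : Measure Z} [IsProbabilityMeasure p] [IsProbabilityMeasure q]
    [IsProbabilityMeasure p₁] [IsProbabilityMeasure q₁]
    [IsProbabilityMeasure p₂] [IsProbabilityMeasure q₂] (h₁ : ℛ p₁ q₁) (h₂ : ℛ p₂ q₂)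
    (hsub : {u : Z →ᵇ ℝ | ∫ z, u z ∂p < ∫ z, u z ∂q} ⊆
      {u : Z →ᵇ ℝ | ∫ z, u z ∂p₁ < ∫ z, u z ∂q₁} ∪
        {u : Z →ᵇ ℝ | ∫ z, u z ∂p₂ < ∫ z, u z ∂q₂}) :
    ℛ p q := by
  obtain ⟨c₁, c₂, hc₁, hc₂, hc⟩ := exists_nonneg_combination_of_forall_nonpos
    (integralDifference p q) (integralDifference p₁ q₁) (integralDifference p₂ q₂) (by
      intro u hu₁ hu₂
      by_contra hu
      have hlt : ∫ z, u z ∂p < ∫ z, u z ∂q := sub_pos.1 (not_le.1 hu)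
      rcases hsub hlt with hm | hm
      · exact (sub_pos.2 hm).not_ge hu₁
      · exact (sub_pos.2 hm).not_ge hu₂)
  replace hc : ∀ u : Z →ᵇ ℝ, ∫ z, u z ∂q - ∫ z, u z ∂p =
      c₁ * (∫ z, u z ∂q₁ - ∫ z, u z ∂p₁) + c₂ * (∫ z, u z ∂q₂ - ∫ z, u z ∂p₂) := hc
  lift c₁ to ℝ≥0 using hc₁
  lift c₂ to ℝ≥0 using hc₂
  rcases eq_zero_or_pos (c₁ + c₂) with h0 | hpos
  · obtain ⟨rfl, rfl⟩ := add_eq_zero.1 h0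
    have : p = q := ext_of_forall_integral_eq_of_IsFiniteMeasure fun u => by
      have := hc u
      simp only [NNReal.coe_zero, zero_mul, add_zero] at this
      linarith
    exact this ▸ hrefl p ‹_›
  have hα : c₁ / (c₁ + c₂) + c₂ / (c₁ + c₂) = 1 := by
    rw [← add_div, div_self hpos.ne']
  have hα' : 1 / (1 + (c₁ + c₂)) + (c₁ + c₂) / (1 + (c₁ + c₂)) = 1 := by
    rw [← add_div, div_self (by positivity)]
  have := isProbabilityMeasure_smul_add_smul p₁ p₂ hα
  have := isProbabilityMeasure_smul_add_smul q₁ q₂ hα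
  have hmix := rel_smul_add_smul htrans hind h₁ h₂ hα
  rw [hind p q _ ‹_› ‹_› (isProbabilityMeasure_smul_add_smul p₁ p₂ hα) _ _
    (by positivity) (by positivity) hα']
  have key := rel_smul_add_smul htrans hind (hrefl p ‹_›) hmix hα'
  have := isProbabilityMeasure_smul_add_smul p ((c₁ / (c₁ + c₂)) • q₁ + (c₂ / (c₁ + c₂)) • q₂) hα'
  have := isProbabilityMeasure_smul_add_smul q ((c₁ / (c₁ + c₂)) • p₁ + (c₂ / (c₁ + c₂)) • p₂) hα'
  convert key using 1
  refine ext_of_forall_integral_eq_of_IsFiniteMeasure fun u => ?_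
  have hpos' : (0 : ℝ) < c₁ + c₂ := by exact_mod_cast hpos
  simp only [integral_smul_add_smul]
  push_cast
  field_simp
  linarith [hc u]

lemma nonempty_setOf_integral_lt {p q : Measure Z} [IsProbabilityMeasure p]
    [IsProbabilityMeasure q] (h : p ≠ q) :
    {u : Z →ᵇ ℝ | ∫ z, u z ∂p < ∫ z, u z ∂q}.Nonempty := by
  by_contra hempty
  have hle : ∀ u : Z →ᵇ ℝ, ∫ z, u z ∂q ≤ ∫ z, u z ∂p := fun u =>
    not_lt.1 fun hu => hempty ⟨u, hu⟩
  refine h (ext_of_forall_integral_eq_of_IsFiniteMeasure fun u => (hle u).antisymm' ?_)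
  have := hle (-u)
  simp only [BoundedContinuousFunction.coe_neg, Pi.neg_apply, integral_neg] at this
  linarith

end

/-- **Corollary 4.3 (preorders satisfying independence).** Let `Z` be a separable
metric space, `ℛ` a binary relation on the Borel probability measures on `Z`, and
`𝒰₀ = { {u ∈ C_b(Z) : ∫ u dp < ∫ u dq} : p, q ∈ Δ(Z) }`. Then `ℛ` is reflexive,
transitive, and satisfies independence iff there is a nonempty family `𝒰` of
nonempty subsets of `C_b(Z)` satisfying the expected multi-utility representation
together with: for all `U₁, U₂, V ∈ 𝒰₀` with `V ⊆ U₁ ∪ U₂`, if no member of `𝒰`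
is contained in `U₁` nor in `U₂`, then no member of `𝒰` is contained in `V`. -/
theorem preorder_independence_iff_multiutility
    {Z : Type*} [MetricSpace Z] [TopologicalSpace.SeparableSpace Z]
    [MeasurableSpace Z] [BorelSpace Z]
    (ℛ : Measure Z → Measure Z → Prop) :
    ((∀ p : Measure Z, IsProbabilityMeasure p → ℛ p p) ∧
      (∀ p q r : Measure Z, IsProbabilityMeasure p → IsProbabilityMeasure q →
        IsProbabilityMeasure r → ℛ p q → ℛ q r → ℛ p r) ∧
      (∀ p q r : Measure Z, IsProbabilityMeasure p → IsProbabilityMeasure q →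
        IsProbabilityMeasure r → ∀ α : ℝ≥0, 0 < α → α < 1 →
          (ℛ p q ↔ ℛ (α • p + (1 - α) • r) (α • q + (1 - α) • r))))
      ↔ ∃ 𝒰 : Set (Set (Z →ᵇ ℝ)), 𝒰.Nonempty ∧ (∀ U ∈ 𝒰, U.Nonempty) ∧
          (∀ p q : Measure Z, IsProbabilityMeasure p → IsProbabilityMeasure q →
            (ℛ p q ↔ ∀ U ∈ 𝒰, ∃ u ∈ U, ∫ z, u z ∂q ≤ ∫ z, u z ∂p)) ∧
          ∀ U₁ U₂ V : Set (Z →ᵇ ℝ),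
            U₁ ∈ {S : Set (Z →ᵇ ℝ) | ∃ p q : Measure Z, IsProbabilityMeasure p ∧
              IsProbabilityMeasure q ∧ S = {u : Z →ᵇ ℝ | ∫ z, u z ∂p < ∫ z, u z ∂q}} →
            U₂ ∈ {S : Set (Z →ᵇ ℝ) | ∃ p q : Measure Z, IsProbabilityMeasure p ∧
              IsProbabilityMeasure q ∧ S = {u : Z →ᵇ ℝ | ∫ z, u z ∂p < ∫ z, u z ∂q}} →
            V ∈ {S : Set (Z →ᵇ ℝ) | ∃ p q : Measure Z, IsProbabilityMeasure p ∧
              IsProbabilityMeasure q ∧ S = {u : Z →ᵇ ℝ | ∫ z, u z ∂p < ∫ z, u z ∂q}} →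
            V ⊆ U₁ ∪ U₂ →
            (¬ ∃ M ∈ 𝒰, M ⊆ U₁) → (¬ ∃ M ∈ 𝒰, M ⊆ U₂) → ¬ ∃ M ∈ 𝒰, M ⊆ V := by
  constructor
  · rintro ⟨hrefl, htrans, hind'⟩
    have hind : ∀ p q r : Measure Z, IsProbabilityMeasure p → IsProbabilityMeasure q →
        IsProbabilityMeasure r → ∀ α β : ℝ≥0, 0 < α → 0 < β → α + β = 1 →
          (ℛ p q ↔ ℛ (α • p + β • r) (α • q + β • r)) := by
      intro p q r hp hq hr α β hα hβ h
      obtain rfl : β = 1 - α := by rw [← h, add_tsub_cancel_left]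
      exact hind' p q r hp hq hr α hα (by rw [← h]; exact lt_add_of_pos_right α hβ)
    let 𝒰 : Set (Set (Z →ᵇ ℝ)) := insert Set.univ
      {S | ∃ p q : Measure Z, IsProbabilityMeasure p ∧ IsProbabilityMeasure q ∧ ¬ ℛ p q ∧
        S = {u : Z →ᵇ ℝ | ∫ z, u z ∂p < ∫ z, u z ∂q}}
    have hrep : ∀ p q : Measure Z, IsProbabilityMeasure p → IsProbabilityMeasure q →
        (ℛ p q ↔ ∀ U ∈ 𝒰, ∃ u ∈ U, ∫ z, u z ∂q ≤ ∫ z, u z ∂p) := by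
      intro p q hp hq
      constructor
      · rintro hpq U (rfl | ⟨p', q', hp', hq', hn, rfl⟩)
        · exact ⟨0, Set.mem_univ _, by simp⟩
        · by_contra! hcon
          exact hn (rel_of_subset_union hrefl htrans hind hpq hpq fun u hu => Or.inl (hcon u hu))
      · intro h
        by_contra hn
        obtain ⟨u, hu, hle⟩ := h _ (Or.inr ⟨p, q, hp, hq, hn, rfl⟩)
        exact hle.not_gt hu
    refine ⟨𝒰, ⟨Set.univ, Or.inl rfl⟩, ?_, hrep, ?_⟩
    · rintro U (rfl | ⟨p, q, hp, hq, hn, rfl⟩)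
      · exact Set.univ_nonempty
      · exact nonempty_setOf_integral_lt fun h => hn (h ▸ hrefl p hp)
    · rintro _ _ _ ⟨p₁, q₁, hp₁, hq₁, rfl⟩ ⟨p₂, q₂, hp₂, hq₂, rfl⟩ ⟨p, q, hp, hq, rfl⟩
        hsub h₁ h₂ ⟨M, hM, hMV⟩
      have r₁ : ℛ p₁ q₁ := by
        by_contra hn
        exact h₁ ⟨_, Or.inr ⟨p₁, q₁, hp₁, hq₁, hn, rfl⟩, subset_rfl⟩
      have r₂ : ℛ p₂ q₂ := by
        by_contra hn
        exact h₂ ⟨_, Or.inr ⟨p₂, q₂, hp₂, hq₂, hn, rfl⟩, subset_rfl⟩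
      obtain ⟨u, hu, hle⟩ := (hrep p q hp hq).1
        (rel_of_subset_union hrefl htrans hind r₁ r₂ hsub) M hM
      exact hle.not_gt (hMV hu)
  · rintro ⟨𝒰, -, hne, hrep, hcov⟩
    have hrel : ∀ p q : Measure Z, IsProbabilityMeasure p → IsProbabilityMeasure q →
        (ℛ p q ↔ ¬ ∃ M ∈ 𝒰, M ⊆ {u : Z →ᵇ ℝ | ∫ z, u z ∂p < ∫ z, u z ∂q}) := by
      intro p q hp hq
      rw [hrep p q hp hq]
      simp only [Set.subset_def, Set.mem_ofPred_eq]
      push Not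
      rfl
    refine ⟨fun p hp => ?_, fun p q r hp hq hr hpq hqr => ?_, fun p q r hp hq hr α hα hα1 => ?_⟩
    · rw [hrel p p hp hp]
      rintro ⟨M, hM, hsub⟩
      obtain ⟨u, hu⟩ := hne M hM
      have hlt : ∫ z, u z ∂p < ∫ z, u z ∂p := hsub hu
      exact lt_irrefl _ hlt
    · rw [hrel _ _ ‹_› ‹_›] at *
      refine hcov _ _ _ ⟨p, q, hp, hq, rfl⟩ ⟨q, r, hq, hr, rfl⟩ ⟨p, r, hp, hr, rfl⟩
        (fun u hu => ?_) hpq hqr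
      by_contra hcon
      simp only [Set.mem_union, Set.mem_ofPred_eq, not_or, not_lt] at hcon hu
      linarith
    · have h1 : α + (1 - α) = 1 := add_tsub_cancel_of_le hα1.le
      rw [hrel p q hp hq, hrel _ _ (isProbabilityMeasure_smul_add_smul p r h1)
        (isProbabilityMeasure_smul_add_smul q r h1)]
      have hα' : (0 : ℝ) < α := by exact_mod_cast hα
      simp only [integral_smul_add_smul, add_lt_add_iff_right, mul_lt_mul_iff_right₀ hα']
end

section
/- Let ℓ∞ be the real Banach space of bounded real sequences with the supremum norm and let (ℓ∞)' be its topological dual. Let ℛ be a nonempty binary relation on ℓ∞ that is (i) positively homogeneous: (x, y) ∈ ℛ and α ≥ 0 imply (αx, αy) ∈ ℛ; and (ii) weakly continuous: for every y ∈ ℓ∞ the sets {x : (x, y) ∈ ℛ} and {x : (y, x) ∈ ℛ} are closed in the weak topology σ(ℓ∞, (ℓ∞)'). Then there exists a nonempty family 𝒦 of nonempty weak*-compact convex subsets of (ℓ∞)' such that 𝒰₀ := {x ∈ ℓ∞ : (x, 0) ∈ ℛ} = {x ∈ ℓ∞ : for every K ∈ 𝒦 there exists μ ∈ K with μ(x)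 ≥ 0}. If, in addition, for every α ∈ ℝ the set {x ∈ ℓ∞ : (x, (α, α, α, …)) ∈ ℛ} is convex, then there exists a nonempty weak*-compact convex set K ⊆ (ℓ∞)' such that 𝒰₀ = {x ∈ ℓ∞ : μ(x) ≥ 0 for all μ ∈ K}. -/
open scoped ENNReal

/-- A point outside a closed cone is separated from it by a weak*-compact convex set of
functionals, all negative at the point, some of which is nonnegative at each cone element. -/
theorem exists_weakDual_compact_convex_separating
    {E : Type*} [NormedAddCommGroup E] [NormedSpace ℝ E] {C : Set E}
    (hC : IsClosed C) (h0 : (0 : E) ∈ C)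
    (hcone : ∀ x ∈ C, ∀ α : ℝ, 0 ≤ α → α • x ∈ C) {x₀ : E} (hx₀ : x₀ ∉ C) :
    ∃ K : Set (WeakDual ℝ E), K.Nonempty ∧ IsCompact K ∧ Convex ℝ K ∧
      (∀ x ∈ C, ∃ μ ∈ K, 0 ≤ μ x) ∧ ∀ μ ∈ K, μ x₀ < 0 := by
  obtain ⟨ε, hε, hball⟩ := Metric.isOpen_iff.1 hC.isOpen_compl x₀ hx₀
  have hx₀_ne : x₀ ≠ 0 := fun h => hx₀ (h ▸ h0)
  obtain ⟨f, hf⟩ : ∃ f : WeakDual ℝ E, f x₀ = -1 := by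
    obtain ⟨f, hf⟩ := SeparatingDual.exists_eq_one (R := ℝ) hx₀_ne
    exact ⟨StrongDual.toWeakDual (-f), congrArg Neg.neg hf⟩
  let B : Set (WeakDual ℝ E) := WeakDual.toStrongDual ⁻¹' Metric.closedBall 0 1
  have hB : IsCompact B := WeakDual.isCompact_closedBall 0 1
  have hBconv : Convex ℝ B :=
    (convex_closedBall 0 1).linear_preimage (WeakDual.toStrongDual (𝕜 := ℝ) (E := E)).toLinearMap
  have h0B : (0 : WeakDual ℝ E) ∈ B := by simp [B]
  let Φ : WeakDual ℝ E → WeakDual ℝ E := fun g => ε • f + (g + g x₀ • f)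
  have hΦ (g : WeakDual ℝ E) (x : E) : Φ g x = ε * f x + (g x + g x₀ * f x) := rfl
  have hΦcont : Continuous Φ :=
    continuous_const.add (continuous_id.add ((WeakDual.eval_continuous x₀).smul continuous_const))
  refine ⟨Φ '' B, ⟨_, 0, h0B, rfl⟩, hB.image hΦcont, ?_, ?_, ?_⟩
  · rintro _ ⟨g, hg, rfl⟩ _ ⟨h, hh, rfl⟩ a b ha hb hab
    refine ⟨a • g + b • h, hBconv hg hh ha hb hab, DFunLike.ext _ _ fun x => ?_⟩
    change ε * f x + ((a * g x + b * h x) + (a * g x₀ + b * h x₀) * f x) =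
      a * (ε * f x + (g x + g x₀ * f x)) + b * (ε * f x + (h x + h x₀ * f x))
    linear_combination -(ε * f x) * hab
  · intro x hx
    by_contra! hneg
    replace hneg : ∀ g ∈ B, ε * f x + (g x + g x₀ * f x) < 0 :=
      fun g hg => hneg _ ⟨g, hg, rfl⟩
    have hfx : f x < 0 := by
      have h := hneg 0 h0B
      change ε * f x + (0 + 0 * f x) < 0 at h
      nlinarith
    obtain ⟨g, hg, hgx⟩ := exists_dual_vector'' ℝ (x + f x • x₀)
    have hlt := hneg (StrongDual.toWeakDual g) (by simpa [B] using hg)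
    change ε * f x + (g x + g x₀ * f x) < 0 at hlt
    simp only [map_add, map_smul, smul_eq_mul, RCLike.ofReal_real_eq_id, id] at hgx
    refine hball (?_ : (-f x)⁻¹ • x ∈ _) (hcone x hx _ (by simpa using hfx.le))
    have heq : (-f x)⁻¹ • x - x₀ = (-f x)⁻¹ • (x + f x • x₀) := by
      rw [smul_add, smul_smul, inv_neg, neg_mul, inv_mul_cancel₀ hfx.ne]
      module
    have hpos : 0 < -f x := neg_pos.2 hfx
    rw [Metric.mem_ball, dist_eq_norm, heq, norm_smul, Real.norm_of_nonneg (inv_pos.2 hpos).le,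
      inv_mul_lt_iff₀ hpos]
    linarith
  · rintro _ ⟨g, -, rfl⟩
    rw [hΦ, hf]
    linarith

/-- A closed cone is represented by a family of weak*-compact convex sets of functionals. -/
theorem exists_weakDual_family_representation
    {E : Type*} [NormedAddCommGroup E] [NormedSpace ℝ E] {C : Set E}
    (hC : IsClosed C) (h0 : (0 : E) ∈ C)
    (hcone : ∀ x ∈ C, ∀ α : ℝ, 0 ≤ α → α • x ∈ C) :
    ∃ 𝒦 : Set (Set (WeakDual ℝ E)), 𝒦.Nonempty ∧
      (∀ K ∈ 𝒦, K.Nonempty ∧ IsCompact K ∧ Convex ℝ K) ∧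
      C = {x : E | ∀ K ∈ 𝒦, ∃ μ ∈ K, 0 ≤ μ x} := by
  refine ⟨{K | (K.Nonempty ∧ IsCompact K ∧ Convex ℝ K) ∧ ∀ x ∈ C, ∃ μ ∈ K, 0 ≤ μ x},
    ⟨{0}, ⟨Set.singleton_nonempty 0, isCompact_singleton, convex_singleton 0⟩,
      fun _ _ => ⟨0, rfl, le_rfl⟩⟩, fun _ hK => hK.1, ?_⟩
  refine Set.Subset.antisymm (fun x hx K hK => hK.2 x hx) fun x hx => ?_
  by_contra hxC
  obtain ⟨K, hKne, hKc, hKconv, hKC, hKx⟩ :=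
    exists_weakDual_compact_convex_separating hC h0 hcone hxC
  obtain ⟨μ, hμ, hμx⟩ := hx K ⟨⟨hKne, hKc, hKconv⟩, hKC⟩
  exact (hKx μ hμ).not_ge hμx

/-- A closed convex cone is the dual cone of a weak*-compact convex set of functionals. -/
theorem exists_weakDual_representation_of_convex
    {E : Type*} [NormedAddCommGroup E] [NormedSpace ℝ E] {C : Set E}
    (hC : IsClosed C) (h0 : (0 : E) ∈ C)
    (hcone : ∀ x ∈ C, ∀ α : ℝ, 0 ≤ α → α • x ∈ C) (hconv : Convex ℝ C) :
    ∃ K : Set (WeakDual ℝ E), K.Nonempty ∧ IsCompact K ∧ Convex ℝ K ∧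
      C = {x : E | ∀ μ ∈ K, 0 ≤ μ x} := by
  let B : Set (WeakDual ℝ E) := WeakDual.toStrongDual ⁻¹' Metric.closedBall 0 1
  have hBconv : Convex ℝ B :=
    (convex_closedBall 0 1).linear_preimage (WeakDual.toStrongDual (𝕜 := ℝ) (E := E)).toLinearMap
  let P : Set (WeakDual ℝ E) := {μ | ∀ x ∈ C, 0 ≤ μ x}
  have hPclosed : IsClosed P := by
    simp only [P, Set.ofPred_forall]
    exact isClosed_iInter fun x => isClosed_iInter fun _ =>
      isClosed_le continuous_const (WeakDual.eval_continuous x)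
  have hPconv : Convex ℝ P := fun μ hμ ν hν a b ha hb _ x hx =>
    add_nonneg (mul_nonneg ha (hμ x hx)) (mul_nonneg hb (hν x hx))
  refine ⟨B ∩ P, ⟨0, by simp [B], fun _ _ => le_rfl⟩,
    (WeakDual.isCompact_closedBall 0 1).inter_right hPclosed, hBconv.inter hPconv, ?_⟩
  refine Set.Subset.antisymm (fun x hx μ hμ => hμ.2 x hx) fun x hx => ?_
  by_contra hxC
  obtain ⟨f, u, hfx, hfC⟩ := geometric_hahn_banach_point_closed hconv hC hxC
  have hu : u < 0 := by simpa using hfC 0 h0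
  have hfP : ∀ y ∈ C, 0 ≤ f y := by
    intro y hy
    by_contra! hneg
    have h := hfC _ (hcone y hy (u / f y) (div_pos_of_neg_of_neg hu hneg).le)
    rw [map_smul, smul_eq_mul, div_mul_cancel₀ _ hneg.ne] at h
    exact h.false
  have hfneg : f x < 0 := hfx.trans hu
  have hnorm : 0 < ‖f‖ := norm_pos_iff.2 fun h => by simp [h] at hfneg
  have hle := hx (StrongDual.toWeakDual (‖f‖⁻¹ • f))
    ⟨by simp [B, norm_smul, hnorm.ne'],
      fun y hy => mul_nonneg (inv_pos.2 hnorm).le (hfP y hy)⟩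
  change 0 ≤ ‖f‖⁻¹ * f x at hle
  exact (mul_neg_of_pos_of_neg (inv_pos.2 hnorm) hfneg).not_ge hle

/-- **Corollary 4.5.** Let `ℛ` be a nonempty binary relation on `ℓ∞` which is
positively homogeneous and weakly continuous. Then the upper section
`𝒰₀ = {x : (x,0) ∈ ℛ}` is represented by a nonempty family of nonempty
weak*-compact convex subsets of `(ℓ∞)'`. If moreover the upper sections at the
constant sequences are convex, then `𝒰₀` is the dual cone of a single nonempty
weak*-compact convex subset of `(ℓ∞)'`. -/
theorem ell_infty_preference_representation
    (ℛ : lp (fun _ : ℕ => ℝ) ∞ → lp (fun _ : ℕ => ℝ) ∞ → Prop)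
    (hne : ∃ x y : lp (fun _ : ℕ => ℝ) ∞, ℛ x y)
    (hhom : ∀ (x y : lp (fun _ : ℕ => ℝ) ∞) (α : ℝ), 0 ≤ α → ℛ x y → ℛ (α • x) (α • y))
    (hcont : ∀ y : lp (fun _ : ℕ => ℝ) ∞,
      IsClosed (toWeakSpace ℝ (lp (fun _ : ℕ => ℝ) ∞) '' {x | ℛ x y}) ∧
      IsClosed (toWeakSpace ℝ (lp (fun _ : ℕ => ℝ) ∞) '' {x | ℛ y x})) :
    (∃ 𝒦 : Set (Set (WeakDual ℝ (lp (fun _ : ℕ => ℝ) ∞))), 𝒦.Nonempty ∧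
      (∀ K ∈ 𝒦, K.Nonempty ∧ IsCompact K ∧ Convex ℝ K) ∧
      {x : lp (fun _ : ℕ => ℝ) ∞ | ℛ x 0}
        = {x : lp (fun _ : ℕ => ℝ) ∞ | ∀ K ∈ 𝒦, ∃ μ ∈ K, 0 ≤ μ x}) ∧
    ((∀ α : ℝ, Convex ℝ {x : lp (fun _ : ℕ => ℝ) ∞ |
        ℛ x (algebraMap ℝ (lp (fun _ : ℕ => ℝ) ∞) α)}) →
      ∃ K : Set (WeakDual ℝ (lp (fun _ : ℕ => ℝ) ∞)), K.Nonempty ∧ IsCompact K ∧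
        Convex ℝ K ∧
        {x : lp (fun _ : ℕ => ℝ) ∞ | ℛ x 0}
          = {x : lp (fun _ : ℕ => ℝ) ∞ | ∀ μ ∈ K, 0 ≤ μ x}) := by
  have h0 : (0 : lp (fun _ : ℕ => ℝ) ∞) ∈ {x | ℛ x 0} := by
    obtain ⟨x, y, hxy⟩ := hne
    simpa using hhom x y 0 le_rfl hxy
  have hcone : ∀ x ∈ {x | ℛ x 0}, ∀ α : ℝ, 0 ≤ α → α • x ∈ {x | ℛ x 0} :=
    fun x hx α hα => by simpa using hhom x 0 α hα hx
  have hclosed : IsClosed {x | ℛ x 0} := by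
    rw [← Set.preimage_image_eq {x | ℛ x 0}
      (toWeakSpace ℝ (lp (fun _ : ℕ => ℝ) ∞)).injective]
    exact (hcont 0).1.preimage (toWeakSpaceCLM ℝ (lp (fun _ : ℕ => ℝ) ∞)).continuous
  exact ⟨exists_weakDual_family_representation hclosed h0 hcone, fun hconv =>
    exists_weakDual_representation_of_convex hclosed h0 hcone (by simpa using hconv 0)⟩
end
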